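/- Let p be a prime, let n, m be positive integers, and let H be a finite abelian p-group with p^n ≥ D(H). Then η(C_{m p^n} ⊕ H) ≤ m p^n + p^n + D(H) - 2. -/

import Mathlib

/-- `S` contains a short zero-sum subsequence: a nonempty subsequence with sum `0`
whose length is at most `exp(G)`. -/
def HasShortZeroSumSubseq {G : Type*} [AddCommGroup G] (S : Multiset G) : Prop :=
  ∃ T, T ≤ S ∧ T.sum = 0 ∧ 1 ≤ Multiset.card T ∧ Multiset.card T ≤ AddMonoid.exponent G

/-- `η G` : the smallest `d` such that every sequence over `G` of length at least `d`
contains a short zero-sum subsequence. -/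
noncomputable def etaConst (G : Type*) [AddCommGroup G] : ℕ :=
  sInf {d : ℕ | ∀ S : Multiset G, d ≤ Multiset.card S → HasShortZeroSumSubseq S}

/-- `D G` : the Davenport constant, the smallest `d` such that every sequence over `G`
of length at least `d` contains a nonempty zero-sum subsequence. -/
noncomputable def davenport (G : Type*) [AddCommGroup G] : ℕ :=
  sInf {d : ℕ | ∀ S : Multiset G, d ≤ Multiset.card S → ∃ T, T ≤ S ∧ T ≠ 0 ∧ T.sum = 0}

/-- `C₀(G)` : the set of `t ∈ [D(G)+1, η(G)-1]` such that every zero-sum sequence over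
`G` of length exactly `t` contains a short zero-sum subsequence. -/
def C0 (G : Type*) [AddCommGroup G] : Set ℕ :=
  {t | davenport G + 1 ≤ t ∧ t ≤ etaConst G - 1 ∧
    ∀ S : Multiset G, Multiset.card S = t → S.sum = 0 → HasShortZeroSumSubseq S}

/-- The augmentation ideal of the group algebra `R[G]`. -/
noncomputable def augmentationIdeal (R G : Type*) [CommRing R] [AddCommGroup G] :
    Ideal (AddMonoidAlgebra R G) :=
  Ideal.span (Set.range fun g : G => AddMonoidAlgebra.single g (1 : R) - 1)

theorem single_sub_one_mem_augmentationIdeal (R : Type*) {G : Type*} [CommRing R]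
    [AddCommGroup G] (g : G) :
    AddMonoidAlgebra.single g (1 : R) - 1 ∈ augmentationIdeal R G :=
  Ideal.subset_span ⟨g, rfl⟩

theorem single_add_one_eq_mul {R G : Type*} [CommRing R] [AddCommGroup G] (g h : G) :
    AddMonoidAlgebra.single (g + h) (1 : R) =
      AddMonoidAlgebra.single g (1 : R) * AddMonoidAlgebra.single h (1 : R) := by
  simp [AddMonoidAlgebra.single_mul_single]

theorem single_add_sub_one_mem {R G : Type*} [CommRing R] [AddCommGroup G]
    {J : Ideal (AddMonoidAlgebra R G)} {g h : G}
    (hg : AddMonoidAlgebra.single g (1 : R) - 1 ∈ J)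
    (hh : AddMonoidAlgebra.single h (1 : R) - 1 ∈ J) :
    AddMonoidAlgebra.single (g + h) (1 : R) - 1 ∈ J := by
  have : AddMonoidAlgebra.single (g + h) (1 : R) - 1 =
      AddMonoidAlgebra.single g (1 : R) * (AddMonoidAlgebra.single h (1 : R) - 1) +
        (AddMonoidAlgebra.single g (1 : R) - 1) := by
    rw [single_add_one_eq_mul]; ring
  rw [this]
  exact J.add_mem (J.mul_mem_left _ hh) hg

theorem augmentationIdeal_le_of_closure_eq_top {R G : Type*} [CommRing R] [AddCommGroup G]
    {s : Set G} (hs : AddSubgroup.closure s = ⊤) {J : Ideal (AddMonoidAlgebra R G)}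
    (hJ : ∀ g ∈ s, AddMonoidAlgebra.single g (1 : R) - 1 ∈ J) :
    augmentationIdeal R G ≤ J := by
  refine Ideal.span_le.2 ?_
  rintro _ ⟨g, rfl⟩
  have hg : g ∈ AddSubgroup.closure s := hs ▸ AddSubgroup.mem_top g
  induction hg using AddSubgroup.closure_induction with
  | mem x hx => exact hJ x hx
  | zero => simp [AddMonoidAlgebra.one_def]
  | add x y _ _ hx hy => exact single_add_sub_one_mem hx hy
  | neg x _ hx =>
    have h1 : AddMonoidAlgebra.single (-x) (1 : R) * AddMonoidAlgebra.single x (1 : R) = 1 := by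
      rw [← single_add_one_eq_mul, neg_add_cancel, AddMonoidAlgebra.one_def]
    have : AddMonoidAlgebra.single (-x) (1 : R) - 1 =
        -(AddMonoidAlgebra.single (-x) (1 : R) * (AddMonoidAlgebra.single x (1 : R) - 1)) := by
      rw [mul_sub, h1]; ring
    change AddMonoidAlgebra.single (-x) (1 : R) - 1 ∈ J
    rw [this]
    exact J.neg_mem (J.mul_mem_left _ hx)

theorem sum_pow_eq_zero_of_pow_eq_zero {A ι : Type*} [CommSemiring A] (s : Finset ι)
    (x : ι → A) (d : ι → ℕ) (hx : ∀ i ∈ s, x i ^ (d i + 1) = 0) :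
    (∑ i ∈ s, x i) ^ (∑ i ∈ s, d i + 1) = 0 := by
  classical
  induction s using Finset.induction_on with
  | empty => simp
  | insert a s ha ih =>
    rw [Finset.sum_insert ha, Finset.sum_insert ha]
    refine (Commute.all _ _).add_pow_eq_zero_of_add_le_succ_of_pow_eq_zero
      (hx a (Finset.mem_insert_self _ _))
      (ih fun i hi => hx i (Finset.mem_insert_of_mem hi)) (by omega)

/-- In characteristic `p`, the augmentation ideal of a finite abelian `p`-group generated by
elements `b i` of orders dividing `p ^ e i` has nilpotency index at most
`1 + ∑ i, (p ^ e i - 1)`. -/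
theorem augmentationIdeal_pow_eq_zero {G ι : Type*} [AddCommGroup G] [Fintype ι] {p : ℕ}
    [Fact p.Prime] (b : ι → G) (e : ι → ℕ) (hb : AddSubgroup.closure (Set.range b) = ⊤)
    (he : ∀ i, p ^ e i • b i = 0) :
    augmentationIdeal (ZMod p) G ^ (∑ i, (p ^ e i - 1) + 1) = 0 := by
  let I : ι → Ideal (AddMonoidAlgebra (ZMod p) G) := fun i =>
    Ideal.span {AddMonoidAlgebra.single (b i) (1 : ZMod p) - 1}
  have hI : ∀ i, I i ^ (p ^ e i - 1 + 1) = 0 := by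
    intro i
    have : CharP (AddMonoidAlgebra (ZMod p) G) p :=
      charP_of_injective_algebraMap (algebraMap (ZMod p) _).injective p
    have hpos : 0 < p ^ e i := pow_pos (Fact.out : p.Prime).pos _
    rw [Nat.sub_add_cancel hpos, Ideal.span_singleton_pow, sub_pow_char_pow,
      AddMonoidAlgebra.single_pow, he i]
    simp [← AddMonoidAlgebra.one_def]
  have hle : augmentationIdeal (ZMod p) G ≤ ∑ i, I i := by
    refine augmentationIdeal_le_of_closure_eq_top hb ?_
    rintro _ ⟨i, rfl⟩
    exact Finset.single_le_sum (f := I) (fun _ _ => bot_le) (Finset.mem_univ i)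
      (Ideal.mem_span_singleton_self _)
  refine le_bot_iff.1 ((Ideal.pow_right_mono hle _).trans (le_of_eq ?_))
  exact sum_pow_eq_zero_of_pow_eq_zero _ _ _ fun i _ => hI i

theorem augmentationIdeal_zmod_pow_eq_zero {p : ℕ} [Fact p.Prime] (n : ℕ) :
    augmentationIdeal (ZMod p) (ZMod (p ^ n)) ^ p ^ n = 0 := by
  have hpos : 0 < p ^ n := pow_pos (Fact.out : p.Prime).pos _
  have h := augmentationIdeal_pow_eq_zero (p := p) (fun _ : Unit => (1 : ZMod (p ^ n)))
    (fun _ => n) ?_ ?_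
  · simpa [Nat.sub_add_cancel hpos] using h
  · refine (AddSubgroup.eq_top_iff' _).2 fun x => ?_
    obtain ⟨k, rfl⟩ := ZMod.intCast_surjective x
    have := AddSubgroup.zsmul_mem _ (AddSubgroup.subset_closure
      (Set.mem_range_self (f := fun _ : Unit => (1 : ZMod (p ^ n))) ())) k
    simpa using this
  · intro _
    rw [nsmul_eq_mul, ZMod.natCast_self, zero_mul]

theorem single_map_sub_one_mem_map_augmentationIdeal {R A B : Type*} [CommRing R] [AddCommGroup A]
    [AddCommGroup B] (f : A →+ B) (a : A) :
    AddMonoidAlgebra.single (f a) (1 : R) - 1 ∈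
      (augmentationIdeal R A).map (AddMonoidAlgebra.mapDomainRingHom R f) := by
  have := Ideal.mem_map_of_mem (AddMonoidAlgebra.mapDomainRingHom R f)
    (single_sub_one_mem_augmentationIdeal R a)
  rw [map_sub, map_one] at this
  simpa using this

theorem augmentationIdeal_prod_pow_eq_zero {R A B : Type*} [CommRing R] [AddCommGroup A]
    [AddCommGroup B] {m n k : ℕ} (hA : augmentationIdeal R A ^ m = 0)
    (hB : augmentationIdeal R B ^ n = 0) (hk : m + n ≤ k + 1) :
    augmentationIdeal R (A × B) ^ k = 0 := by
  set I := (augmentationIdeal R A).map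
    (AddMonoidAlgebra.mapDomainRingHom R (AddMonoidHom.inl A B))
  set J := (augmentationIdeal R B).map
    (AddMonoidAlgebra.mapDomainRingHom R (AddMonoidHom.inr A B))
  have hI : I ^ m = 0 := by rw [← Ideal.map_pow, hA]; exact Ideal.map_bot
  have hJ : J ^ n = 0 := by rw [← Ideal.map_pow, hB]; exact Ideal.map_bot
  have hle : augmentationIdeal R (A × B) ≤ I + J := by
    refine Ideal.span_le.2 ?_
    rintro _ ⟨⟨a, b⟩, rfl⟩
    have h := single_add_sub_one_mem (J := I + J)
      (Ideal.mem_sup_left (single_map_sub_one_mem_map_augmentationIdeal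
        (AddMonoidHom.inl A B) a))
      (Ideal.mem_sup_right (single_map_sub_one_mem_map_augmentationIdeal
        (AddMonoidHom.inr A B) b))
    simpa using h
  refine le_bot_iff.1 ((Ideal.pow_right_mono hle _).trans (le_of_eq ?_))
  exact (Commute.all _ _).add_pow_eq_zero_of_add_le_succ_of_pow_eq_zero hI hJ hk

theorem exists_sum_eq_of_coeff_prod_ne_zero {R G : Type*} [CommRing R] [AddCommGroup G]
    (S : Multiset G) (h : G)
    (hh : ((S.map fun g => 1 - AddMonoidAlgebra.single g (1 : R)).prod - 1).coeff h ≠ 0) :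
    ∃ T ≤ S, T ≠ 0 ∧ T.sum = h := by
  induction S using Multiset.induction_on generalizing h with
  | empty => simp at hh
  | cons a S ih =>
    set f := (S.map fun g => 1 - AddMonoidAlgebra.single g (1 : R)).prod - 1 with hf
    have key : ((a ::ₘ S).map fun g => 1 - AddMonoidAlgebra.single g (1 : R)).prod - 1 =
        f - AddMonoidAlgebra.single a 1 - AddMonoidAlgebra.single a 1 * f := by
      rw [Multiset.map_cons, Multiset.prod_cons, hf]; ring
    rw [key] at hh
    by_cases h1 : f.coeff h = 0
    · by_cases h2 : a = h
      · exact ⟨{a}, by simp, by simp, by simpa using h2⟩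
      · have h3 : f.coeff (-a + h) ≠ 0 := by
          intro h3
          apply hh
          simp [h1, h2, h3]
        obtain ⟨T, hT, -, hsum⟩ := ih _ h3
        exact ⟨a ::ₘ T, Multiset.cons_le_cons _ hT, by simp, by simp [hsum]⟩
    · obtain ⟨T, hT, h0, hsum⟩ := ih _ h1
      exact ⟨T, hT.trans (Multiset.le_cons_self _ _), h0, hsum⟩

theorem prod_one_sub_single_mem {R G : Type*} [CommRing R] [AddCommGroup G] (S : Multiset G) :
    (S.map fun g => 1 - AddMonoidAlgebra.single g (1 : R)).prod ∈
      augmentationIdeal R G ^ Multiset.card S := by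
  induction S using Multiset.induction_on with
  | empty => simp
  | cons a S ih =>
    rw [Multiset.map_cons, Multiset.prod_cons, Multiset.card_cons, pow_succ']
    refine Ideal.mul_mem_mul ?_ ih
    rw [← neg_sub]
    exact neg_mem (single_sub_one_mem_augmentationIdeal R a)

/-- The Davenport constant is bounded by the nilpotency index of the augmentation ideal. -/
theorem exists_zero_sum_of_augmentationIdeal_pow_eq_zero {R G : Type*} [CommRing R]
    [Nontrivial R] [AddCommGroup G] {N : ℕ} (hN : augmentationIdeal R G ^ N = 0)
    (S : Multiset G) (hS : N ≤ Multiset.card S) :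
    ∃ T ≤ S, T ≠ 0 ∧ T.sum = 0 := by
  apply exists_sum_eq_of_coeff_prod_ne_zero (R := R)
  have h0 : (S.map fun g => 1 - AddMonoidAlgebra.single g (1 : R)).prod = 0 := by
    have := Ideal.pow_le_pow_right hS (prod_one_sub_single_mem (R := R) S)
    rwa [hN] at this
  rw [h0]
  simp [AddMonoidAlgebra.one_def]

theorem exists_map_eq_of_le_map {α β : Type*} {f : α → β} {S : Multiset α} {T : Multiset β}
    (h : T ≤ S.map f) : ∃ U ≤ S, U.map f = T := by
  classical
  induction S using Multiset.induction_on generalizing T with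
  | empty => exact ⟨0, le_rfl, by simpa using (Multiset.le_zero.1 h).symm⟩
  | cons a S ih =>
    rw [Multiset.map_cons] at h
    by_cases ha : f a ∈ T
    · obtain ⟨T', rfl⟩ := Multiset.exists_cons_of_mem ha
      obtain ⟨U, hU, rfl⟩ := ih ((Multiset.cons_le_cons_iff _).1 h)
      exact ⟨a ::ₘ U, Multiset.cons_le_cons _ hU, by simp⟩
    · obtain ⟨U, hU, rfl⟩ := ih ((Multiset.le_cons_of_notMem ha).1 h)
      exact ⟨U, hU.trans (Multiset.le_cons_self _ _), rfl⟩

theorem exists_le_card_eq {α : Type*} {S : Multiset α} {k : ℕ} (h : k ≤ Multiset.card S) :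
    ∃ T ≤ S, Multiset.card T = k := by
  induction S using Quotient.inductionOn with
  | h l => exact ⟨(l.take k : List α), (List.take_sublist _ _).subperm,
      by rw [Multiset.coe_card, List.length_take]; exact min_eq_left h⟩

/-- Lower bound for the Davenport constant from a family of elements that is independent with
respect to coordinate maps to cyclic groups. -/
theorem sum_sub_one_add_one_le_of_forall_exists_zero_sum {G ι : Type*} [AddCommGroup G] [Fintype ι]
    [DecidableEq ι] (n : ι → ℕ) (b : ι → G) (π : ∀ i, G →+ ZMod (n i))
    (hπ : ∀ i j, π i (b j) = if j = i then 1 else 0) {d : ℕ}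
    (hd : ∀ S : Multiset G, d ≤ Multiset.card S → ∃ T, T ≤ S ∧ T ≠ 0 ∧ T.sum = 0) :
    ∑ i, (n i - 1) + 1 ≤ d := by
  by_contra! hlt
  let S : Multiset ι := ∑ i, Multiset.replicate (n i - 1) i
  have hcard : Multiset.card S = ∑ i, (n i - 1) := by simp [S]
  have hcount : ∀ i, S.count i = n i - 1 := by
    intro i
    simp [S, Multiset.count_sum', Multiset.count_replicate]
  obtain ⟨T, hT, hT0, hsum⟩ := hd (S.map b) (by rw [Multiset.card_map]; omega)
  obtain ⟨U, hU, rfl⟩ := exists_map_eq_of_le_map hT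
  have hproj : ∀ (V : Multiset ι) i, π i (V.map b).sum = (V.count i : ZMod (n i)) := by
    intro V i
    induction V using Multiset.induction_on with
    | empty => simp
    | cons a V ih =>
      rw [Multiset.map_cons, Multiset.sum_cons, map_add, ih, hπ, Multiset.count_cons]
      by_cases h : a = i
      · simp [h, add_comm]
      · simp [h, Ne.symm h]
  obtain ⟨i, hi⟩ := Multiset.exists_mem_of_ne_zero (s := U) (by rintro rfl; simp at hT0)
  have h1 : 0 < U.count i := Multiset.count_pos.2 hi
  have h2 : U.count i ≤ n i - 1 := hcount i ▸ Multiset.count_le_of_le i hU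
  have h3 := hproj U i
  rw [hsum, map_zero, eq_comm, ZMod.natCast_eq_zero_iff] at h3
  have := Nat.le_of_dvd h1 h3
  omega

/-- For a finite abelian `p`-group, the augmentation ideal over `ZMod p` has nilpotency index at
most the Davenport constant. -/
theorem augmentationIdeal_pow_davenport_eq_zero {p : ℕ} [Fact p.Prime] (H : Type*)
    [AddCommGroup H] [Fintype H] (hH : ∃ k : ℕ, Fintype.card H = p ^ k) :
    augmentationIdeal (ZMod p) H ^ davenport H = 0 := by
  classical
  have hp : p.Prime := Fact.out
  obtain ⟨k, hk⟩ := hH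
  obtain ⟨ι, _, q, hq, e, ⟨f⟩⟩ := AddCommGroup.equiv_directSum_zmod_of_finite H
  have hdvd : ∀ i, ∃ a, q i ^ e i = p ^ a := by
    intro i
    have h1 : addOrderOf (f.symm (DirectSum.of (fun i => ZMod (q i ^ e i)) i 1)) = q i ^ e i := by
      rw [AddEquiv.addOrderOf_eq, addOrderOf_injective _ (DirectSum.of_injective i),
        ZMod.addOrderOf_one]
    have h2 : q i ^ e i ∣ p ^ k := by
      rw [← h1, ← hk]
      exact addOrderOf_dvd_card
    obtain ⟨a, -, ha⟩ := (Nat.dvd_prime_pow hp).1 h2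
    exact ⟨a, ha⟩
  choose a ha using hdvd
  let b : ι → H := fun i => f.symm (DirectSum.of (fun i => ZMod (q i ^ e i)) i 1)
  have hpow : augmentationIdeal (ZMod p) H ^ (∑ i, (p ^ a i - 1) + 1) = 0 := by
    refine augmentationIdeal_pow_eq_zero b a ?_ ?_
    · refine (AddSubgroup.eq_top_iff' _).2 fun x => ?_
      obtain ⟨y, rfl⟩ := f.symm.surjective x
      induction y using DirectSum.induction_on with
      | zero => simp
      | of i x =>
        obtain ⟨z, rfl⟩ := ZMod.intCast_surjective x
        have := AddSubgroup.zsmul_mem _ (AddSubgroup.subset_closure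
          (Set.mem_range_self (f := b) i)) z
        simpa [b, ← map_zsmul] using this
      | add x y hx hy => rw [map_add]; exact AddSubgroup.add_mem _ hx hy
    · intro i
      rw [← ha i, ← map_nsmul, ← map_nsmul, nsmul_eq_mul, ZMod.natCast_self, zero_mul,
        map_zero, map_zero]
  have hle : ∑ i, (p ^ a i - 1) + 1 ≤ davenport H := by
    simp only [← ha]
    refine le_csInf ⟨_, fun S hS => exists_zero_sum_of_augmentationIdeal_pow_eq_zero hpow S hS⟩
      fun d hd => ?_
    refine sum_sub_one_add_one_le_of_forall_exists_zero_sum (fun i => q i ^ e i) b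
      (fun i => (DFinsupp.evalAddMonoidHom i).comp f.toAddMonoidHom) (fun i j => ?_) hd
    by_cases h : j = i
    · subst h
      simp only [b, AddMonoidHom.comp_apply, AddEquiv.coe_toAddMonoidHom,
        AddEquiv.apply_symm_apply, if_true]
      exact DirectSum.of_eq_same (β := fun i => ZMod (q i ^ e i)) j 1
    · simp only [b, AddMonoidHom.comp_apply, AddEquiv.coe_toAddMonoidHom,
        AddEquiv.apply_symm_apply, h, if_false]
      exact DirectSum.of_eq_of_ne (β := fun i => ZMod (q i ^ e i)) j i 1 (Ne.symm h)
  exact le_bot_iff.1 ((Ideal.pow_le_pow_right hle).trans (le_of_eq hpow))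

theorem exists_zero_sum_of_card_le {K : Type*} [AddCommGroup K] [Finite K] (S : Multiset K)
    (hS : Nat.card K ≤ Multiset.card S) : ∃ T ≤ S, T ≠ 0 ∧ T.sum = 0 := by
  induction S using Quotient.inductionOn with
  | h l =>
  replace hS : Nat.card K ≤ l.length := hS
  have hninj : ¬ Function.Injective fun i : Fin (l.length + 1) => (l.take i).sum := by
    intro hinj
    have := Nat.card_le_card_of_injective _ hinj
    rw [Nat.card_eq_fintype_card, Fintype.card_fin] at this
    omega
  obtain ⟨i, j, hij, hlt⟩ : ∃ i j : Fin (l.length + 1),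
      (l.take i).sum = (l.take j).sum ∧ i < j := by
    simp only [Function.Injective, not_forall] at hninj
    obtain ⟨i, j, h, hne⟩ := hninj
    rcases lt_or_gt_of_ne hne with h' | h'
    · exact ⟨i, j, h, h'⟩
    · exact ⟨j, i, h.symm, h'⟩
  have hlt' : (i : ℕ) < j := hlt
  have hj : (j : ℕ) ≤ l.length := Nat.lt_succ_iff.1 j.2
  refine ⟨((l.take j).drop i : List K), ?_, ?_, ?_⟩
  · exact ((List.drop_sublist _ _).trans (List.take_sublist _ _)).subperm
  · rw [← Multiset.card_pos, Multiset.coe_card, List.length_drop, List.length_take]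
    omega
  · have h := List.sum_take_add_sum_drop (l.take j) i
    rw [List.take_take, min_eq_left hlt'.le, hij] at h
    simpa using h

/-- If the augmentation ideal of `H` over `ZMod p` has nilpotency index at most `N ≤ p ^ n`, then
sequences of length at least `2 * p ^ n + N - 2` over `ZMod (p ^ n) × H` contain zero-sum
subsequences of length at most `p ^ n`. -/
theorem exists_short_zero_sum {p : ℕ} [Fact p.Prime] {n N : ℕ} {H : Type*} [AddCommGroup H]
    (hH : augmentationIdeal (ZMod p) H ^ N = 0) (hN : 1 ≤ N) (hNp : N ≤ p ^ n)
    (S : Multiset (ZMod (p ^ n) × H)) (hS : 2 * p ^ n + N - 2 ≤ Multiset.card S) :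
    ∃ T ≤ S, T.sum = 0 ∧ 1 ≤ Multiset.card T ∧ Multiset.card T ≤ p ^ n := by
  classical
  have hC := augmentationIdeal_zmod_pow_eq_zero (p := p) n
  have hG : augmentationIdeal (ZMod p) (ZMod (p ^ n) × H) ^ (p ^ n + N - 1) = 0 :=
    augmentationIdeal_prod_pow_eq_zero hC hH (by omega)
  have hCG : augmentationIdeal (ZMod p) (ZMod (p ^ n) × (ZMod (p ^ n) × H)) ^
      (2 * p ^ n + N - 2) = 0 :=
    augmentationIdeal_prod_pow_eq_zero hC hG (by omega)
  obtain ⟨S', hS', hcard⟩ := exists_le_card_eq hS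
  obtain ⟨T₀, hT₀, hne, hsum⟩ := exists_zero_sum_of_augmentationIdeal_pow_eq_zero hCG
    (S'.map fun g => ((1 : ZMod (p ^ n)), g)) (by rw [Multiset.card_map, hcard])
  obtain ⟨T, hT, rfl⟩ := exists_map_eq_of_le_map hT₀
  have hpair : ∀ V : Multiset (ZMod (p ^ n) × H),
      (V.map fun g => ((1 : ZMod (p ^ n)), g)).sum =
        ((Multiset.card V : ZMod (p ^ n)), V.sum) := by
    intro V
    induction V using Multiset.induction_on with
    | empty => simp [Prod.zero_eq_mk]
    | cons a V ih =>
      rw [Multiset.map_cons, Multiset.sum_cons, ih, Multiset.sum_cons, Multiset.card_cons]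
      ext <;> simp [add_comm]
  rw [hpair, Prod.mk_eq_zero, ZMod.natCast_eq_zero_iff] at hsum
  obtain ⟨⟨c, hc⟩, hsum⟩ := hsum
  have hpos : 0 < Multiset.card T := by
    rw [Multiset.card_pos]; rintro rfl; simp at hne
  have hle : Multiset.card T ≤ 2 * p ^ n + N - 2 := hcard ▸ Multiset.card_le_card hT
  have hTS : T ≤ S := hT.trans hS'
  have hc3 : c < 3 := by
    by_contra! h
    have := Nat.mul_le_mul_left (p ^ n) h
    omega
  interval_cases c
  · omega
  · exact ⟨T, hTS, hsum, hpos, by omega⟩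
  · obtain ⟨a, ha⟩ := Multiset.card_pos_iff_exists_mem.1 hpos
    obtain ⟨T', rfl⟩ := Multiset.exists_cons_of_mem ha
    rw [Multiset.card_cons] at hc
    obtain ⟨U, hU, hU0, hUsum⟩ := exists_zero_sum_of_augmentationIdeal_pow_eq_zero hG T' (by omega)
    obtain ⟨V, rfl⟩ := Multiset.le_iff_exists_add.1 hU
    have hUpos : 0 < Multiset.card U := Multiset.card_pos.2 hU0
    rw [Multiset.card_add] at hc
    by_cases hUle : Multiset.card U ≤ p ^ n
    · exact ⟨U, (hU.trans (Multiset.le_cons_self _ _)).trans hTS, hUsum, hUpos, hUle⟩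
    · refine ⟨a ::ₘ V, le_trans (Multiset.cons_le_cons _ (Multiset.le_add_left _ _)) hTS,
        ?_, ?_, ?_⟩
      · simpa [hUsum] using hsum
      · simp
      · rw [Multiset.card_cons]; omega

/-- Repeatedly extracting short subsequences whose sum lies in the kernel of `f`. -/
theorem exists_disjoint_subsequences {G G' : Type*} [AddCommGroup G] [AddCommGroup G']
    (f : G →+ G') {q N : ℕ}
    (hf : ∀ S : Multiset G', N ≤ Multiset.card S →
      ∃ T ≤ S, T.sum = 0 ∧ 1 ≤ Multiset.card T ∧ Multiset.card T ≤ q)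
    (k : ℕ) (S : Multiset G) (hS : k * q + N ≤ Multiset.card S + q) :
    ∃ 𝒯 : Multiset (Multiset G), Multiset.card 𝒯 = k ∧ 𝒯.sum ≤ S ∧
      ∀ T ∈ 𝒯, f T.sum = 0 ∧ 1 ≤ Multiset.card T ∧ Multiset.card T ≤ q := by
  classical
  induction k generalizing S with
  | zero => exact ⟨0, by simp⟩
  | succ k ih =>
    have hkq : (k + 1) * q = k * q + q := by ring
    obtain ⟨T₀, hT₀, hsum, h1, hq⟩ := hf (S.map f) (by rw [Multiset.card_map]; omega)
    obtain ⟨T, hT, rfl⟩ := exists_map_eq_of_le_map hT₀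
    rw [Multiset.card_map] at h1 hq
    obtain ⟨V, rfl⟩ := Multiset.le_iff_exists_add.1 hT
    rw [Multiset.card_add] at hS
    obtain ⟨𝒯, hcard, hle, h𝒯⟩ := ih V (by omega)
    refine ⟨T ::ₘ 𝒯, by simp [hcard], by simpa using hle, ?_⟩
    intro U hU
    rcases Multiset.mem_cons.1 hU with rfl | hU
    · exact ⟨by rw [map_multiset_sum, hsum], h1, hq⟩
    · exact h𝒯 U hU

theorem card_sum_le_card_mul {α : Type*} {q : ℕ} (𝒯 : Multiset (Multiset α))
    (h : ∀ T ∈ 𝒯, Multiset.card T ≤ q) :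
    Multiset.card 𝒯.sum ≤ Multiset.card 𝒯 * q := by
  induction 𝒯 using Multiset.induction_on with
  | empty => simp
  | cons T 𝒯 ih =>
    rw [Multiset.sum_cons, Multiset.card_add, Multiset.card_cons, add_one_mul, add_comm]
    exact Nat.add_le_add (ih fun U hU => h U (Multiset.mem_cons_of_mem hU))
      (h T (Multiset.mem_cons_self _ _))

/-- Zero-sum subsequences of length at most `q` over a quotient of `G` by a subgroup of order `m`
lift to zero-sum subsequences of length at most `m * q` over `G`. -/
theorem exists_short_zero_sum_of_hom {G G' : Type*} [AddCommGroup G] [AddCommGroup G']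
    (f : G →+ G') [Finite f.ker] {q N : ℕ}
    (hf : ∀ S : Multiset G', N ≤ Multiset.card S →
      ∃ T ≤ S, T.sum = 0 ∧ 1 ≤ Multiset.card T ∧ Multiset.card T ≤ q)
    (S : Multiset G) (hS : Nat.card f.ker * q + N ≤ Multiset.card S + q) :
    ∃ T ≤ S, T.sum = 0 ∧ 1 ≤ Multiset.card T ∧ Multiset.card T ≤ Nat.card f.ker * q := by
  obtain ⟨𝒯, hcard, hle, h𝒯⟩ := exists_disjoint_subsequences f hf _ S hS
  let σ : {T // T ∈ 𝒯} → f.ker := fun T => ⟨T.1.sum, (h𝒯 T.1 T.2).1⟩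
  obtain ⟨R₀, hR₀, hR0, hRsum⟩ := exists_zero_sum_of_card_le (𝒯.attach.map σ)
    (by rw [Multiset.card_map, Multiset.card_attach, hcard])
  obtain ⟨R, hR, rfl⟩ := exists_map_eq_of_le_map hR₀
  have hR𝒯 : R.map Subtype.val ≤ 𝒯 := by
    simpa using Multiset.map_le_map (f := Subtype.val) hR
  have hmem : ∀ T ∈ R.map Subtype.val, T ∈ 𝒯 := fun T hT => Multiset.mem_of_le hR𝒯 hT
  refine ⟨(R.map Subtype.val).sum, ?_, ?_, ?_, ?_⟩
  · obtain ⟨V, hV⟩ := Multiset.le_iff_exists_add.1 hR𝒯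
    have h := congrArg Multiset.sum hV
    rw [Multiset.sum_add] at h
    exact (h ▸ Multiset.le_add_right _ _ : _ ≤ 𝒯.sum).trans hle
  · have h := congrArg f.ker.subtype hRsum
    rw [map_multiset_sum, Multiset.map_map, map_zero] at h
    rw [← Multiset.coe_sumAddMonoidHom, map_multiset_sum, Multiset.map_map]
    exact h
  · obtain ⟨T, hT⟩ := Multiset.exists_mem_of_ne_zero (s := R) (by rintro rfl; simp at hR0)
    have hT' : T.1 ≤ (R.map Subtype.val).sum :=
      Multiset.single_le_sum (fun _ _ => Multiset.zero_le _) _ (Multiset.mem_map_of_mem _ hT)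
    exact (h𝒯 T.1 T.2).2.1.trans (Multiset.card_le_card hT')
  · refine (card_sum_le_card_mul _ fun T hT => (h𝒯 T (hmem T hT)).2.2).trans ?_
    rw [← hcard]
    exact Nat.mul_le_mul_right _ (Multiset.card_le_card hR𝒯)

theorem stmt_16 (p : ℕ) (hp : p.Prime) (n m : ℕ) (hn : 0 < n) (hm : 0 < m)
    (H : Type*) [AddCommGroup H] [Fintype H] (hHp : ∃ k : ℕ, Fintype.card H = p ^ k)
    (hpD : davenport H ≤ p ^ n) :
    etaConst (ZMod (m * p ^ n) × H) ≤ m * p ^ n + p ^ n + davenport H - 2 := by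
  have : Fact p.Prime := ⟨hp⟩
  have hq : 0 < p ^ n := pow_pos hp.pos n
  have : NeZero (p ^ n) := ⟨hq.ne'⟩
  have : NeZero (m * p ^ n) := ⟨(Nat.mul_pos hm hq).ne'⟩
  have hH := augmentationIdeal_pow_davenport_eq_zero (p := p) H hHp
  have hD : 1 ≤ davenport H := by
    by_contra! h
    rw [Nat.lt_one_iff.1 h, pow_zero] at hH
    exact one_ne_zero hH
  have hdvd : p ^ n ∣ m * p ^ n := Dvd.intro_left m rfl
  let f : ZMod (m * p ^ n) × H →+ ZMod (p ^ n) × H :=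
    AddMonoidHom.prodMap
      (ZMod.castHom hdvd (ZMod (p ^ n))).toAddMonoidHom (AddMonoidHom.id H)
  have hsurj : Function.Surjective f :=
    Function.Surjective.prodMap (ZMod.castHom_surjective hdvd) Function.surjective_id
  have hker : Nat.card f.ker = m := by
    have h := f.ker.card_mul_index
    rw [AddSubgroup.index_ker, AddMonoidHom.range_eq_top.2 hsurj, AddSubgroup.card_top,
      Nat.card_prod, Nat.card_prod, Nat.card_zmod, Nat.card_zmod, mul_assoc] at h
    have hc : 0 < p ^ n * Nat.card H := Nat.mul_pos hq Nat.card_pos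
    rw [← mul_assoc, ← mul_assoc, mul_assoc, mul_assoc m] at h
    exact Nat.eq_of_mul_eq_mul_right hc h
  refine Nat.sInf_le fun S hS => ?_
  obtain ⟨T, hT, hsum, h1, hle⟩ := exists_short_zero_sum_of_hom f
    (exists_short_zero_sum (n := n) hH hD hpD) S (by rw [hker]; omega)
  refine ⟨T, hT, hsum, h1, hle.trans ?_⟩
  rw [hker]
  refine Nat.le_of_dvd (Nat.pos_of_ne_zero AddMonoid.exponent_ne_zero_of_finite) ?_
  rw [AddMonoid.exponent_prod, ZMod.exponent]
  exact dvd_lcm_left _ _
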